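/- arXiv:2406.16396 — 6 statements merged into one kernel-verified Lean document; each statement's English description precedes it below -/
import Mathlib

section
/- For every integer k ≥ 1, the (2k−1)-st Taylor coefficient of the tangent function at 0 satisfies (2k−1)! · [z^{2k−1}] tan z = 2(4^k − 1)ζ(2k)/π^{2k}, where ζ is the Riemann zeta function; moreover all even-order Taylor coefficients of tan at 0 vanish. Equivalently, setting t_n := n! · (n-th Taylor coefficient of tan at 0), one has t_{2k−1} = (2k−1)! · 2(4^k − 1)ζ(2k)/π^{2k} and t_{2k} = 0. -/
open Real

/-- The Riemann zeta function at positive integer arguments,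
`ζ(s) = Σ_{i ≥ 1} 1/i^s`. -/
noncomputable def zeta (s : ℕ) : ℝ := ∑' i : ℕ+, (1 : ℝ) / (i : ℝ) ^ s

/-- `t n = n! · [z^n] tan z`, i.e. the `n`-th derivative of `tan` at `0`;
it counts strictly increasing binary trees of size `n`. -/
noncomputable def t (n : ℕ) : ℝ := iteratedDeriv n Real.tan 0

theorem cot_aux (x : ℝ) (hx0 : x ≠ 0) (hx1 : |x| < 1) :
    HasSum (fun k : ℕ => -2 * zeta (2 * k + 2) * x ^ (2 * k + 1))
      (π * Real.cot (π * x) - 1 / x) := by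
  have hmem : (x : ℂ) ∈ Complex.integerComplement := by
    rw [Complex.mem_integerComplement_iff]
    rintro ⟨n, hn⟩
    have hn' : (n : ℝ) = x := by exact_mod_cast hn
    rw [← hn'] at hx0 hx1
    have h1 : |n| < 1 := by exact_mod_cast hx1
    have h2 : n ≠ 0 := by exact_mod_cast hx0
    exact h2 (Int.abs_lt_one_iff.mp h1)
  have hcot : π * Real.cot (π * x) - 1 / x =
      ∑' n : ℕ, (1 / (x - (n + 1)) + 1 / (x + (n + 1))) := by
    have h := cot_series_rep' hmem
    exact_mod_cast h
  have hxsq : x ^ 2 < 1 := by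
    rw [← sq_abs]; nlinarith [abs_nonneg x]
  have hz : Summable (fun n : ℕ => 1 / ((n : ℝ) + 1) ^ 2) := by
    have := (summable_nat_add_iff 1).mpr (Real.summable_one_div_nat_pow.mpr (one_lt_two))
    simpa using this
  let F : ℕ × ℕ → ℝ := fun p => -2 * (x ^ (2 * p.1 + 1) / ((p.2 : ℝ) + 1) ^ (2 * p.1 + 2))
  have hF : Summable F := by
    have hg : Summable (fun k : ℕ => 2 * (x ^ 2) ^ k) :=
      (summable_geometric_of_lt_one (sq_nonneg x) hxsq).mul_left 2
    have hm := hg.mul_of_nonneg hz (fun k => by positivity) (fun n => by positivity)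
    refine Summable.of_norm_bounded hm ?_
    rintro ⟨k, n⟩
    simp only [F, norm_mul, norm_div, norm_pow, Real.norm_eq_abs]
    have hn : (0 : ℝ) ≤ n := Nat.cast_nonneg n
    rw [abs_neg, abs_of_pos (by norm_num : (0 : ℝ) < 2),
      abs_of_pos (by positivity : (0 : ℝ) < (n : ℝ) + 1), mul_assoc, ← div_eq_mul_one_div]
    have h1 : |x| ^ (2 * k + 1) ≤ (x ^ 2) ^ k := by
      rw [pow_succ, pow_mul, sq_abs]
      exact mul_le_of_le_one_right (by positivity) hx1.le
    have h2 : ((n : ℝ) + 1) ^ 2 ≤ ((n : ℝ) + 1) ^ (2 * k + 2) :=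
      pow_le_pow_right₀ (by linarith) (by omega)
    gcongr
  have hfib1 : ∀ k, HasSum (fun n => F (k, n)) (-2 * zeta (2 * k + 2) * x ^ (2 * k + 1)) := by
    intro k
    have hs := (hF.prod_factor k).hasSum
    convert! hs using 1
    have h0 := tsum_pnat_eq_tsum_succ (f := fun n : ℕ => (1 : ℝ) / (n : ℝ) ^ (2 * k + 2))
    simp only [zeta]
    rw [h0]
    simp only [F]
    rw [tsum_mul_left, mul_assoc, ← tsum_mul_right]
    congr 2
    ext n
    push_cast
    ring
  have hfib2 : ∀ n, HasSum (fun k => F (k, n)) (1 / (x - ((n : ℝ) + 1)) + 1 / (x + ((n : ℝ) + 1))) := by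
    intro n
    have hn : (0 : ℝ) ≤ n := Nat.cast_nonneg n
    have hr : x ^ 2 / ((n : ℝ) + 1) ^ 2 < 1 := by
      rw [div_lt_one (by positivity)]; nlinarith
    have hg := (hasSum_geometric_of_lt_one (by positivity) hr).mul_left
      (-2 * (x / ((n : ℝ) + 1) ^ 2))
    have hb := abs_lt.mp hx1
    have e1 : x - ((n : ℝ) + 1) ≠ 0 := by intro h; linarith
    have e2 : x + ((n : ℝ) + 1) ≠ 0 := by intro h; linarith
    have e3 : (n : ℝ) + 1 ≠ 0 := by positivity
    have e4 : ((n : ℝ) + 1) ^ 2 - x ^ 2 ≠ 0 := by intro h; nlinarith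
    have hv : 1 / (x - ((n : ℝ) + 1)) + 1 / (x + ((n : ℝ) + 1)) =
        -2 * (x / ((n : ℝ) + 1) ^ 2) * (1 - x ^ 2 / ((n : ℝ) + 1) ^ 2)⁻¹ := by
      rw [one_sub_div (by positivity), inv_div]
      field_simp
      ring
    rw [hv]
    convert! hg using 1
    · ext k
      simp only [F]
      rw [div_pow, ← pow_mul, ← pow_mul, pow_add, pow_add]
      field_simp
  have hA := hF.hasSum.prod_fiberwise hfib1
  have hF' : Summable (F ∘ Prod.swap) := hF.prod_symm
  have hB := hF'.hasSum.prod_fiberwise hfib2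
  rw [hcot, hB.tsum_eq]
  have : ∑' p, (F ∘ Prod.swap) p = ∑' p, F p := (Equiv.prodComm ℕ ℕ).tsum_eq F
  rw [this]
  exact hA

theorem tan_aux (x : ℝ) (hx : |x| < 1 / 2) :
    HasSum (fun k : ℕ => 2 * (4 ^ (k + 1) - 1) * zeta (2 * k + 2) * x ^ (2 * k + 1))
      (π * Real.tan (π * x)) := by
  rcases eq_or_ne x 0 with rfl | h0
  · simpa using hasSum_zero
  have h1 := cot_aux x h0 (by linarith)
  have h2 := cot_aux (2 * x) (by simpa using h0) (by
    rw [abs_mul, abs_of_pos (by norm_num : (0 : ℝ) < 2)]; linarith)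
  have h3 := h1.sub (h2.mul_left 2)
  have hb := abs_lt.mp hx
  have hc : Real.cos (π * x) ≠ 0 := by
    apply (Real.cos_pos_of_mem_Ioo ⟨_, _⟩).ne' <;> nlinarith [Real.pi_pos]
  have hs : Real.sin (π * x) ≠ 0 := by
    intro h
    rw [Real.sin_eq_zero_iff_of_lt_of_lt (by nlinarith [Real.pi_pos])
      (by nlinarith [Real.pi_pos])] at h
    exact (mul_ne_zero Real.pi_ne_zero h0) h
  convert! h3 using 1
  · ext k
    rw [mul_pow, pow_succ (2 : ℝ), pow_mul (2 : ℝ)]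
    norm_num
    ring
  · rw [Real.cot_eq_cos_div_sin, Real.cot_eq_cos_div_sin, Real.tan_eq_sin_div_cos,
      show π * (2 * x) = 2 * (π * x) by ring, Real.sin_two_mul, Real.cos_two_mul]
    have := Real.sin_sq_add_cos_sq (π * x)
    field_simp
    linear_combination π * x * this

noncomputable def tanCoeff (n : ℕ) : ℝ :=
  if Even n then 0 else 2 * (2 ^ (n + 1) - 1) * zeta (n + 1) / π ^ (n + 1)

theorem tan_hasSum (y : ℝ) (hy : |y| < 1) :
    HasSum (fun n : ℕ => y ^ n * tanCoeff n) (Real.tan y) := by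
  have hpi := Real.pi_gt_three
  have h := (tan_aux (y / π) (by
    rw [abs_div, abs_of_pos Real.pi_pos, div_lt_iff₀ Real.pi_pos]; linarith)).mul_left (1 / π)
  rw [← zero_add (Real.tan y)]
  refine HasSum.even_add_odd ?_ ?_
  · simpa [tanCoeff] using hasSum_zero
  · have e : π * (y / π) = y := by field_simp
    rw [e, ← mul_assoc, one_div_mul_cancel Real.pi_ne_zero, one_mul] at h
    convert! h using 1
    ext k
    have ho : ¬ Even (2 * k + 1) := by simp
    have h4 : (2 : ℝ) ^ (2 * k + 1 + 1) = 4 ^ (k + 1) := by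
      rw [show 2 * k + 1 + 1 = 2 * (k + 1) by ring, pow_mul]; norm_num
    rw [tanCoeff, if_neg ho, h4, div_pow, pow_succ π (2 * k + 1)]
    field_simp

theorem t_eq (n : ℕ) : t n = (Nat.factorial n : ℝ) * tanCoeff n := by
  have h1 : HasFPowerSeriesAt Real.tan (FormalMultilinearSeries.ofScalars ℝ tanCoeff) 0 := by
    rw [hasFPowerSeriesAt_iff]
    filter_upwards [Metric.ball_mem_nhds (0 : ℝ) one_pos] with y hy
    have := tan_hasSum y (by simpa using hy)
    simpa [FormalMultilinearSeries.coeff_ofScalars] using this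
  have h2 := AnalyticAt.hasFPowerSeriesAt h1.analyticAt
  have h3 := congrArg (fun p => FormalMultilinearSeries.coeff p n)
    (h1.eq_formalMultilinearSeries h2)
  simp only [FormalMultilinearSeries.coeff_ofScalars] at h3
  rw [h3, t]
  field_simp

/-- For every `k ≥ 1`, `t_{2k-1} = (2k-1)! · 2(4^k - 1)ζ(2k)/π^{2k}`,
and all even-order Taylor coefficients of `tan` at `0` vanish. -/
theorem tan_taylor_coeff (k : ℕ) (hk : 1 ≤ k) :
    t (2 * k - 1) =
      (Nat.factorial (2 * k - 1) : ℝ) * (2 * (4 ^ k - 1) * zeta (2 * k) / π ^ (2 * k)) ∧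
    t (2 * k) = 0 := by
  constructor
  · have ho : ¬ Even (2 * k - 1) := by
      rw [Nat.not_even_iff_odd]; exact ⟨k - 1, by omega⟩
    rw [t_eq, tanCoeff, if_neg ho, show 2 * k - 1 + 1 = 2 * k by omega, pow_mul (2 : ℝ)]
    norm_num
  · rw [t_eq, tanCoeff, if_pos (by simp), mul_zero]
end

section
/- For every integer l ≥ 2, the sequence (f_k) is decreasing on the range 1 ≤ k ≤ ⌊l/2⌋: for all integers k with 1 ≤ k ≤ ⌊l/2⌋ − 1, one has f_{k+1} ≤ f_k. -/
/-- `f l k = (4^k − 1) ζ(2k) (4^{l−k} − 1) ζ(2(l−k))`. -/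
noncomputable def f (l k : ℕ) : ℝ :=
  (4 ^ k - 1) * zeta (2 * k) * ((4 ^ (l - k) - 1) * zeta (2 * (l - k)))

noncomputable def xo (n : ℕ) : ℝ := 1 / (2 * (n : ℝ) + 1) ^ 2

lemma xo_pos (n : ℕ) : 0 < xo n := by unfold xo; positivity

lemma zsum (k : ℕ) (hk : 1 ≤ k) : Summable (fun n : ℕ => (1 : ℝ) / ((n : ℝ) + 1) ^ (2 * k)) := by
  have h := (Real.summable_one_div_nat_pow (p := 2 * k)).2 (by omega)
  have h2 := (summable_nat_add_iff 1).2 h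
  simpa using h2

lemma xo_pow (k n : ℕ) : xo n ^ k = 1 / (((2 * n : ℕ) : ℝ) + 1) ^ (2 * k) := by
  unfold xo
  rw [div_pow, one_pow, ← pow_mul]
  push_cast
  rfl

lemma xsum (k : ℕ) (hk : 1 ≤ k) : Summable (fun n : ℕ => xo n ^ k) := by
  have h := (zsum k hk).comp_injective (i := fun n : ℕ => 2 * n) (fun a b h => by simpa using h)
  refine h.congr fun n => ?_
  rw [xo_pow]
  rfl

lemma zeta_odd (k : ℕ) (hk : 1 ≤ k) :
    (4 ^ k - 1) * zeta (2 * k) = 4 ^ k * ∑' n : ℕ, xo n ^ k := by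
  have hz : zeta (2 * k) = ∑' n : ℕ, (1 : ℝ) / ((n : ℝ) + 1) ^ (2 * k) := by
    unfold zeta
    rw [tsum_pnat_eq_tsum_succ (f := fun n : ℕ => (1 : ℝ) / (n : ℝ) ^ (2 * k))]
    push_cast
    rfl
  have hodd : ∀ n : ℕ, (1 : ℝ) / (((2 * n + 1 : ℕ) : ℝ) + 1) ^ (2 * k)
      = (1 / 4 ^ k) * (1 / ((n : ℝ) + 1) ^ (2 * k)) := by
    intro n
    have : (((2 * n + 1 : ℕ) : ℝ) + 1) = 2 * ((n : ℝ) + 1) := by push_cast; ring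
    rw [this, mul_pow, pow_mul 2 2 k]
    norm_num
    ring
  have hs : (∑' n : ℕ, xo n ^ k) + (1 / 4 ^ k) * zeta (2 * k) = zeta (2 * k) := by
    have h := tsum_even_add_odd (f := fun n : ℕ => (1 : ℝ) / ((n : ℝ) + 1) ^ (2 * k))
      ((xsum k hk).congr fun n => by rw [xo_pow])
      (((zsum k hk).mul_left (1 / 4 ^ k)).congr fun n => by rw [hodd])
    rw [hz, ← tsum_mul_left]
    refine Eq.trans ?_ h
    congr 1
    · exact tsum_congr fun n => xo_pow k n
    · exact tsum_congr fun n => (hodd n).symm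
  have h4 : (4 : ℝ) ^ k ≠ 0 := by positivity
  field_simp at hs
  linarith

lemma key (k p : ℕ) (hk : 1 ≤ k) :
    (∑' n : ℕ, xo n ^ (k + 1)) * (∑' n : ℕ, xo n ^ (k + p))
      ≤ (∑' n : ℕ, xo n ^ k) * (∑' n : ℕ, xo n ^ (k + p + 1)) := by
  set A := ∑' n : ℕ, xo n ^ k with hA
  set B := ∑' n : ℕ, xo n ^ (k + 1) with hB
  have s0 := xsum k hk
  have s1 := xsum (k + 1) (by omega)
  have s2 := xsum (k + p) (by omega)
  have s3 := xsum (k + p + 1) (by omega)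
  have hApos : 0 < A := s0.tsum_pos (fun n => (pow_pos (xo_pos n) k).le) 0 (pow_pos (xo_pos 0) k)
  have hB0 : 0 ≤ B := tsum_nonneg fun n => (pow_pos (xo_pos n) _).le
  set r := B / A with hr
  have hr0 : 0 ≤ r := by positivity
  have hBr : B = r * A := by rw [hr]; field_simp
  have hsum := ((s3.hasSum.sub (s2.hasSum.mul_left r)).sub
    ((s1.hasSum.sub (s0.hasSum.mul_left r)).mul_left (r ^ p)))
  have hnn := hsum.nonneg (fun n => by
    have e : xo n ^ (k + p + 1) - r * xo n ^ (k + p) - r ^ p * (xo n ^ (k + 1) - r * xo n ^ k)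
      = xo n ^ k * ((xo n - r) * (xo n ^ p - r ^ p)) := by ring
    rw [e]
    refine mul_nonneg (pow_pos (xo_pos n) k).le ?_
    rcases le_total r (xo n) with h | h
    · exact mul_nonneg (sub_nonneg.2 h) (sub_nonneg.2 (pow_le_pow_left₀ hr0 h p))
    · exact mul_nonneg_of_nonpos_of_nonpos (sub_nonpos.2 h)
        (sub_nonpos.2 (pow_le_pow_left₀ (xo_pos n).le h p)))
  rw [← hA, ← hB, ← hBr] at hnn
  simp only [sub_self, mul_zero, sub_zero] at hnn
  rw [hBr]
  nlinarith [mul_nonneg hApos.le hnn]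

/-- For `l ≥ 2`, the sequence `(f_k)` is decreasing on `1 ≤ k ≤ ⌊l/2⌋`:
for `1 ≤ k ≤ ⌊l/2⌋ − 1`, `f_{k+1} ≤ f_k`. -/
theorem f_decreasing (l k : ℕ) (hl : 2 ≤ l) (hk : 1 ≤ k) (hk' : k ≤ l / 2 - 1) :
    f l (k + 1) ≤ f l k := by
  obtain ⟨p, rfl⟩ : ∃ p, l = k + (k + p + 1) := ⟨l - k - (k + 1), by omega⟩
  have e1 : k + (k + p + 1) - (k + 1) = k + p := by omega
  have e2 : k + (k + p + 1) - k = k + p + 1 := by omega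
  unfold f
  rw [e1, e2, zeta_odd _ hk, zeta_odd (k + 1) (by omega), zeta_odd (k + p) (by omega),
    zeta_odd (k + p + 1) (by omega)]
  have h := mul_le_mul_of_nonneg_left (key k p hk)
    (show (0 : ℝ) ≤ 4 ^ k * 4 ^ (k + p + 1) by positivity)
  calc _ = _ := by ring
    _ ≤ _ := h
    _ = _ := by ring
end

section
/- For every integer l ≥ 2 and every k ∈ {1, 2, …, l−1}, one has f_1 ≥ f_k ≥ f_{⌊l/2⌋}, and moreover the ratio satisfies f_1 / f_{⌊l/2⌋} ≤ 4π⁴/45 ≤ 9. -/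
open Real

/-- Terms of the odd zeta sum. -/
noncomputable def oddx (i : ℕ) : ℝ := 1 / (2 * (i : ℝ) + 1) ^ 2

/-- Odd zeta sum. -/
noncomputable def oddz (n : ℕ) : ℝ := ∑' i : ℕ, oddx i ^ n

lemma oddx_pos (i : ℕ) : 0 < oddx i := by unfold oddx; positivity

lemma summable_nat (n : ℕ) (hn : 1 ≤ n) : Summable (fun i : ℕ => 1 / (i : ℝ) ^ (2 * n)) :=
  Real.summable_one_div_nat_pow.mpr (by omega)

lemma oddx_pow (i n : ℕ) : oddx i ^ n = 1 / ((2 * i + 1 : ℕ) : ℝ) ^ (2 * n) := by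
  unfold oddx; push_cast; rw [div_pow, one_pow, ← pow_mul]

lemma oddx_summable (n : ℕ) (hn : 1 ≤ n) : Summable (fun i => oddx i ^ n) := by
  simp_rw [oddx_pow]
  exact (summable_nat n hn).comp_injective (i := fun i : ℕ => 2 * i + 1) (fun a b h => by
    simp only at h; omega)

lemma zeta_nat (n : ℕ) (hn : 1 ≤ n) : zeta (2 * n) = ∑' i : ℕ, 1 / (i : ℝ) ^ (2 * n) := by
  unfold zeta
  rw [tsum_pnat_eq_tsum_succ (f := fun i : ℕ => 1 / (i : ℝ) ^ (2 * n)),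
    (summable_nat n hn).tsum_eq_zero_add]
  have : 2 * n ≠ 0 := by omega
  simp [this]

lemma bridge (n : ℕ) (hn : 1 ≤ n) : (4 ^ n - 1) * zeta (2 * n) = 4 ^ n * oddz n := by
  have hs := summable_nat n hn
  have h := tsum_even_add_odd (f := fun i : ℕ => 1 / (i : ℝ) ^ (2 * n))
    (hs.comp_injective (i := fun i : ℕ => 2 * i) (fun a b h => by simp only at h; omega))
    (hs.comp_injective (i := fun i : ℕ => 2 * i + 1) (fun a b h => by simp only at h; omega))
  rw [← zeta_nat n hn] at h
  have h1 : ∑' i : ℕ, 1 / ((2 * i : ℕ) : ℝ) ^ (2 * n) = (1 / 4 ^ n) * zeta (2 * n) := by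
    rw [zeta_nat n hn, ← tsum_mul_left]
    congr 1; ext i
    push_cast
    rw [mul_pow, pow_mul 2 2 n]
    norm_num [mul_comm]
  have h2 : ∑' i : ℕ, 1 / ((2 * i + 1 : ℕ) : ℝ) ^ (2 * n) = oddz n := by
    unfold oddz; simp_rw [oddx_pow]
  rw [h1, h2] at h
  have h4 : (4 : ℝ) ^ n ≠ 0 := by positivity
  field_simp at h
  linarith

lemma oddz_ge (n : ℕ) (hn : 1 ≤ n) : 1 ≤ oddz n := by
  have := (oddx_summable n hn).le_tsum 0 (fun i _ => (pow_pos (oddx_pos i) n).le)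
  have h0 : oddx 0 ^ n = 1 := by simp [oddx]
  rw [h0] at this
  exact this

lemma pow_cheb (x y : ℝ) (hx : 0 < x) (hy : 0 < y) (a p q : ℕ) :
    x ^ (a + p) * y ^ (a + q) + y ^ (a + p) * x ^ (a + q) ≤
      x ^ a * y ^ (a + p + q) + y ^ a * x ^ (a + p + q) := by
  have h : 0 ≤ (y ^ p - x ^ p) * (y ^ q - x ^ q) := by
    rcases le_total x y with h | h
    · exact mul_nonneg (sub_nonneg.2 (pow_le_pow_left₀ hx.le h _))
        (sub_nonneg.2 (pow_le_pow_left₀ hx.le h _))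
    · exact mul_nonneg_of_nonpos_of_nonpos (sub_nonpos.2 (pow_le_pow_left₀ hy.le h _))
        (sub_nonpos.2 (pow_le_pow_left₀ hy.le h _))
  have h2 : 0 ≤ x ^ a * y ^ a * ((y ^ p - x ^ p) * (y ^ q - x ^ q)) := by positivity
  simp only [pow_add]
  linarith

lemma oddz_conv (a p q : ℕ) (ha : 1 ≤ a) :
    oddz (a + p) * oddz (a + q) ≤ oddz a * oddz (a + p + q) := by
  have key : ∀ m n : ℕ, 1 ≤ m → 1 ≤ n →
      HasSum (fun z : ℕ × ℕ => oddx z.1 ^ m * oddx z.2 ^ n) (oddz m * oddz n) := by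
    intro m n hm hn
    exact (oddx_summable m hm).hasSum.mul (oddx_summable n hn).hasSum
      ((oddx_summable m hm).mul_of_nonneg (oddx_summable n hn)
        (fun i => (pow_pos (oddx_pos i) _).le) (fun i => (pow_pos (oddx_pos i) _).le))
  have h := hasSum_le (fun z : ℕ × ℕ => by
      have := pow_cheb (oddx z.1) (oddx z.2) (oddx_pos _) (oddx_pos _) a p q
      rw [mul_comm (oddx z.2 ^ (a + p)), mul_comm (oddx z.2 ^ a)] at this
      exact this)
    ((key (a + p) (a + q) (by omega) (by omega)).add (key (a + q) (a + p) (by omega) (by omega)))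
    ((key a (a + p + q) (by omega) (by omega)).add (key (a + p + q) a (by omega) (by omega)))
  linarith

lemma f_eq (l k : ℕ) (hk : 1 ≤ k) (hk' : k + 1 ≤ l) :
    f l k = 4 ^ l * (oddz k * oddz (l - k)) := by
  unfold f
  rw [bridge k hk, bridge (l - k) (by omega)]
  have : (4 : ℝ) ^ l = 4 ^ k * 4 ^ (l - k) := by rw [← pow_add]; congr 1; omega
  rw [this]; ring

lemma oddz_one : oddz 1 = π ^ 2 / 8 := by
  have h := bridge 1 le_rfl
  rw [zeta_nat 1 le_rfl] at h
  have h2 := hasSum_zeta_two.tsum_eq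
  simp only [mul_one, pow_one] at h
  rw [h2] at h
  linarith

lemma oddz_anti (n : ℕ) (hn : 1 ≤ n) : oddz n ≤ oddz 1 := by
  refine (oddx_summable n hn).tsum_le_tsum (fun i => ?_) (oddx_summable 1 le_rfl)
  refine pow_le_pow_of_le_one (oddx_pos i).le ?_ hn
  unfold oddx
  rw [div_le_one (by positivity)]
  exact one_le_pow₀ (by linarith [(Nat.cast_nonneg i : (0 : ℝ) ≤ i)])

/-- For `l ≥ 2` and `k ∈ {1, …, l−1}`, `f_1 ≥ f_k ≥ f_{⌊l/2⌋}` and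
`f_1 / f_{⌊l/2⌋} ≤ 4π⁴/45 ≤ 9`. -/
theorem f_bounds (l k : ℕ) (hl : 2 ≤ l) (hk : 1 ≤ k) (hk' : k ≤ l - 1) :
    f l 1 ≥ f l k ∧ f l k ≥ f l (l / 2) ∧
      f l 1 / f l (l / 2) ≤ 4 * π ^ 4 / 45 ∧ 4 * π ^ 4 / 45 ≤ 9 := by
  rw [f_eq l 1 le_rfl (by omega), f_eq l k hk (by omega), f_eq l (l / 2) (by omega) (by omega)]
  have h4 : (0 : ℝ) < 4 ^ l := by positivity
  refine ⟨?_, ?_, ?_, ?_⟩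
  · have h := oddz_conv 1 (k - 1) (l - k - 1) le_rfl
    rw [show 1 + (k - 1) + (l - k - 1) = l - 1 by omega, show 1 + (k - 1) = k by omega,
      show 1 + (l - k - 1) = l - k by omega] at h
    exact mul_le_mul_of_nonneg_left h h4.le
  · refine mul_le_mul_of_nonneg_left ?_ h4.le
    rcases le_or_gt k (l / 2) with hc | hc
    · have h := oddz_conv k (l / 2 - k) (l - l / 2 - k) hk
      rwa [show k + (l / 2 - k) + (l - l / 2 - k) = l - k by omega,
        show k + (l / 2 - k) = l / 2 by omega,
        show k + (l - l / 2 - k) = l - l / 2 by omega] at h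
    · have h := oddz_conv (l - k) (l / 2 - (l - k)) (l - l / 2 - (l - k)) (by omega)
      rw [show l - k + (l / 2 - (l - k)) + (l - l / 2 - (l - k)) = k by omega,
        show l - k + (l / 2 - (l - k)) = l / 2 by omega,
        show l - k + (l - l / 2 - (l - k)) = l - l / 2 by omega] at h
      linarith
  · rw [mul_div_mul_left _ _ h4.ne']
    have h1 := oddz_ge (l / 2) (by omega)
    have h2 := oddz_ge (l - l / 2) (by omega)
    have h3 := oddz_anti (l - 1) (by omega)
    have h5 := oddz_one
    have h6 : 1 ≤ oddz (l / 2) * oddz (l - l / 2) := one_le_mul_of_one_le_of_one_le h1 h2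
    have h7 : oddz 1 * oddz (l - 1) ≤ oddz 1 * oddz 1 :=
      mul_le_mul_of_nonneg_left h3 (by rw [h5]; positivity)
    have hp : 0 < π ^ 4 := by positivity
    have h8 : oddz 1 * oddz 1 = π ^ 4 / 64 := by rw [h5]; ring
    rw [div_le_iff₀ (by linarith)]
    nlinarith
  · have : π ^ 4 ≤ 3.15 ^ 4 := pow_le_pow_left₀ pi_pos.le pi_lt_d2.le 4
    norm_num at this ⊢
    linarith
end

section
/- The number of strictly increasing binary trees of odd size 2k−1 satisfies the asymptotic equivalence t_{2k−1} ~ 2 (2/π)^{2k} (2k−1)! as k → ∞; that is, lim_{k→∞} t_{2k−1} / ( 2 (2/π)^{2k} (2k−1)! ) = 1. -/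
open Real Filter

open PowerSeries in
theorem tan_ps : (PowerSeries.mk fun n => t n / (Nat.factorial n : ℝ)) * PowerSeries.cos ℝ
    = PowerSeries.sin ℝ := by
  have hs : PowerSeries.sin ℝ =
      PowerSeries.mk fun n => iteratedDeriv n Real.sin 0 / (Nat.factorial n : ℝ) := by
    ext n
    rcases Nat.even_or_odd' n with ⟨k, rfl | rfl⟩
    · simp [PowerSeries.sin]
    · have : (2 * k + 1) / 2 = k := by omega
      simp [PowerSeries.sin, this]
  have hc : PowerSeries.cos ℝ =
      PowerSeries.mk fun n => iteratedDeriv n Real.cos 0 / (Nat.factorial n : ℝ) := by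
    ext n
    rcases Nat.even_or_odd' n with ⟨k, rfl | rfl⟩
    · simp [PowerSeries.cos]
    · simp [PowerSeries.cos]
  rw [hs, hc]
  ext n
  have he : (Real.tan * Real.cos) =ᶠ[nhds 0] Real.sin := by
    have : ∀ᶠ x in nhds (0 : ℝ), Real.cos x ≠ 0 :=
      Real.continuous_cos.continuousAt.eventually_ne (by simp)
    filter_upwards [this] with x hx
    simp [Real.tan_mul_cos hx]
  rw [PowerSeries.coeff_mk, ← he.iteratedDeriv_eq n,
    iteratedDeriv_mul (Real.contDiffAt_tan.2 (by simp)) Real.contDiff_cos.contDiffAt,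
    PowerSeries.coeff_mul, Finset.Nat.sum_antidiagonal_eq_sum_range_succ_mk, Finset.sum_div]
  refine Finset.sum_congr rfl fun i hi => ?_
  have hi' : i ≤ n := Nat.lt_succ_iff.mp (Finset.mem_range.mp hi)
  simp only [PowerSeries.coeff_mk, t]
  rw [Nat.cast_choose ℝ hi']
  have h1 : (Nat.factorial n : ℝ) ≠ 0 := by positivity
  have h2 : (Nat.factorial i : ℝ) ≠ 0 := by positivity
  have h3 : (Nat.factorial (n - i) : ℝ) ≠ 0 := by positivity
  field_simp

open PowerSeries in
theorem exp_I (ε : ℂ) (hε : ε = 1 ∨ ε = -1) :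
    rescale (ε * Complex.I) (PowerSeries.exp ℂ) =
      PowerSeries.cos ℂ + C (ε * Complex.I) * PowerSeries.sin ℂ := by
  have he2 : ε ^ 2 = 1 := by rcases hε with rfl | rfl <;> norm_num
  ext n
  rcases Nat.even_or_odd' n with ⟨k, rfl | rfl⟩
  · rw [map_add, coeff_C_mul, coeff_rescale, pow_mul, mul_pow, he2]
    simp [PowerSeries.sin, PowerSeries.cos, div_eq_mul_inv]
  · have : (2 * k + 1) / 2 = k := by omega
    rw [map_add, coeff_C_mul, coeff_rescale, pow_succ, pow_mul, mul_pow, he2]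
    simp [PowerSeries.sin, PowerSeries.cos, div_eq_mul_inv, this]
    ring

open PowerSeries in
theorem tan_bern : C (2 * Complex.I) * X * (C Complex.I *
      PowerSeries.map (algebraMap ℝ ℂ) (PowerSeries.mk fun n => t n / (Nat.factorial n : ℝ))) =
    C (2 * Complex.I) * X - 2 * (rescale (2 * Complex.I) (bernoulliPowerSeries ℂ)
      - rescale (4 * Complex.I) (bernoulliPowerSeries ℂ)) := by
  have hT := congrArg (PowerSeries.map (algebraMap ℝ ℂ)) tan_ps
  rw [map_mul, map_cos, map_sin] at hT
  generalize PowerSeries.map (algebraMap ℝ ℂ)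
    (PowerSeries.mk fun n => t n / (Nat.factorial n : ℝ)) = T at *
  have hp := exp_I 1 (Or.inl rfl)
  have hm := exp_I (-1) (Or.inr rfl)
  have hpm := exp_mul_exp_eq_exp_add (1 * Complex.I) (-1 * Complex.I)
  have he := exp_mul_exp_eq_exp_add (1 * Complex.I) (1 * Complex.I)
  have hee := exp_mul_exp_eq_exp_add (2 * Complex.I) (2 * Complex.I)
  have h1 := congrArg (rescale (2 * Complex.I)) (bernoulliPowerSeries_mul_exp_sub_one ℂ)
  have h2 := congrArg (rescale (4 * Complex.I)) (bernoulliPowerSeries_mul_exp_sub_one ℂ)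
  rw [map_mul, map_sub, map_one, rescale_X] at h1 h2
  rw [show 1 * Complex.I + 1 * Complex.I = 2 * Complex.I by ring] at he
  rw [show 2 * Complex.I + 2 * Complex.I = 4 * Complex.I by ring] at hee
  rw [show 1 * Complex.I + -1 * Complex.I = 0 by ring] at hpm
  have h0 : rescale (0 : ℂ) (PowerSeries.exp ℂ) = 1 := by simp
  rw [h0] at hpm
  have h4 : (C (4 * Complex.I) : ℂ⟦X⟧) = 2 * C (2 * Complex.I) := by
    rw [show (4 * Complex.I) = 2 * (2 * Complex.I) by ring, map_mul, map_ofNat]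
  have hne : rescale (4 * Complex.I) (PowerSeries.exp ℂ) - 1 ≠ 0 := by
    intro h
    rw [h, mul_zero] at h2
    have := congrArg (PowerSeries.coeff 1) h2
    simp at this
  rw [h4] at h2
  simp only [one_mul, neg_mul, map_neg] at hp hm hpm he
  generalize rescale (4 * Complex.I) (PowerSeries.exp ℂ) = e2 at *
  generalize rescale (2 * Complex.I) (PowerSeries.exp ℂ) = e at *
  generalize rescale (Complex.I) (PowerSeries.exp ℂ) = p at *
  generalize rescale (-Complex.I) (PowerSeries.exp ℂ) = m at *
  generalize rescale (4 * Complex.I) (bernoulliPowerSeries ℂ) = B2 at *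
  generalize rescale (2 * Complex.I) (bernoulliPowerSeries ℂ) = B1 at *
  generalize (C (2 * Complex.I) : ℂ⟦X⟧) = y at *
  generalize (C (Complex.I) : ℂ⟦X⟧) = i at *
  generalize PowerSeries.sin ℂ = s at *
  generalize PowerSeries.cos ℂ = c at *
  have key : i * T * (e + 1) = e - 1 := by
    have a1 : e + 1 = 2 * p * c := by rw [← he, ← hpm, hp, hm]; ring
    have a2 : e - 1 = 2 * p * (i * s) := by rw [← he, ← hpm, hp, hm]; ring
    rw [a1, a2, ← hT]; ring
  apply mul_right_cancel₀ hne
  subst hee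
  linear_combination y * X * (e - 1) * key + 2 * (e + 1) * h1 - 2 * h2

theorem t_formula (k : ℕ) (hk : k ≠ 0) :
    t (2 * k - 1) / (Nat.factorial (2 * k - 1) : ℝ) =
      (1 - 4 ^ k) * (-4) ^ k * ((bernoulli (2 * k) : ℝ) / (Nat.factorial (2 * k) : ℝ)) := by
  obtain ⟨j, rfl⟩ := Nat.exists_eq_succ_of_ne_zero hk
  have h := congrArg (PowerSeries.coeff (2 * j + 1 + 1)) tan_bern
  have e1 : 2 * (j + 1) = 2 * j + 1 + 1 := by ring
  have e2 : 2 * (j + 1) - 1 = 2 * j + 1 := by omega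
  simp only [Nat.succ_eq_add_one]
  rw [e2]
  rw [mul_assoc, PowerSeries.coeff_C_mul, PowerSeries.coeff_succ_X_mul, PowerSeries.coeff_C_mul,
    PowerSeries.coeff_map, PowerSeries.coeff_mk, map_sub, PowerSeries.coeff_C_mul,
    PowerSeries.coeff_X, if_neg (by omega), ← map_ofNat (PowerSeries.C (R := ℂ)) 2,
    PowerSeries.coeff_C_mul, map_sub,
    PowerSeries.coeff_rescale, PowerSeries.coeff_rescale, bernoulliPowerSeries,
    PowerSeries.coeff_mk, ← e1, pow_mul, pow_mul, mul_pow 2 Complex.I, mul_pow 4 Complex.I,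
    Complex.I_sq] at h
  have hr : (algebraMap ℚ ℂ) (bernoulli (2 * (j + 1)) / (Nat.factorial (2 * (j + 1)) : ℚ)) =
     (((bernoulli (2 * (j + 1)) : ℝ) / (Nat.factorial (2 * (j + 1)) : ℝ) : ℝ) : ℂ) := by
    simp
  rw [hr] at h
  generalize (bernoulli (2 * (j + 1)) : ℝ) / (Nat.factorial (2 * (j + 1)) : ℝ) = b at *
  generalize t (2 * j + 1) / (Nat.factorial (2 * j + 1) : ℝ) = a at *
  apply Complex.ofReal_injective
  have h16 : ((4 : ℂ) ^ 2 * -1) ^ (j + 1) = 4 ^ (j + 1) * (-4) ^ (j + 1) := by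
    rw [← mul_pow]; norm_num
  have h22 : ((2 : ℂ) ^ 2 * -1) ^ (j + 1) = (-4) ^ (j + 1) := by norm_num
  rw [h16, h22] at h
  simp only [Complex.coe_algebraMap] at h
  push_cast
  linear_combination (-1 / 2 : ℂ) * h + a * Complex.I_sq

theorem zeta_tendsto :
    Tendsto (fun k : ℕ => ∑' n : ℕ, 1 / (n : ℝ) ^ (2 * k)) atTop (nhds 1) := by
  have h1 : ∑' n : ℕ, (if n = 1 then (1 : ℝ) else 0) = 1 := by simp
  suffices h : Tendsto (fun k : ℕ => ∑' n : ℕ, 1 / (n : ℝ) ^ (2 * k)) atTop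
      (nhds (∑' n : ℕ, (if n = 1 then (1 : ℝ) else 0))) by rwa [h1] at h
  apply tendsto_tsum_of_dominated_convergence (bound := fun n : ℕ => 1 / (n : ℝ) ^ 2)
  · exact Real.summable_one_div_nat_pow.2 (by norm_num)
  · intro n
    rcases Nat.lt_or_ge 1 n with h | h
    · rw [if_neg (by omega)]
      have hn : (1 : ℝ) < n := by exact_mod_cast h
      have := tendsto_pow_atTop_nhds_zero_of_lt_one (r := 1 / (n : ℝ) ^ 2) (by positivity)
        (by rw [div_lt_one (by positivity)]; exact one_lt_pow₀ hn (by norm_num))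
      refine this.congr fun k => ?_
      rw [div_pow, one_pow, pow_mul]
    · interval_cases n
      · refine tendsto_const_nhds.congr' ?_
        filter_upwards [eventually_gt_atTop 0] with k hk
        simp [hk.ne']
      · simp
  · filter_upwards [eventually_gt_atTop 0] with k hk n
    rw [Real.norm_of_nonneg (by positivity)]
    rcases Nat.eq_zero_or_pos n with rfl | hn
    · simp [hk.ne']
    · have hn : (1 : ℝ) ≤ n := by exact_mod_cast hn
      have h2 : 2 ≤ 2 * k := by omega
      exact one_div_le_one_div_of_le (by positivity) (pow_le_pow_right₀ hn h2)

/-- `t_{2k−1} ~ 2 (2/π)^{2k} (2k−1)!` as `k → ∞`. -/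
theorem t_asymptotic :
    Tendsto (fun k : ℕ =>
        t (2 * k - 1) / (2 * (2 / π) ^ (2 * k) * (Nat.factorial (2 * k - 1) : ℝ)))
      atTop (nhds 1) := by
  have h4 : Tendsto (fun k : ℕ => (1 - (1 / 4 : ℝ) ^ k)) atTop (nhds 1) := by
    simpa using (tendsto_pow_atTop_nhds_zero_of_lt_one (r := (1 / 4 : ℝ)) (by norm_num)
      (by norm_num)).const_sub 1
  have h := h4.mul zeta_tendsto
  rw [one_mul] at h
  refine h.congr' ?_
  filter_upwards [eventually_gt_atTop 0] with k hk
  have hf := t_formula k hk.ne'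
  rw [(hasSum_zeta_nat hk.ne').tsum_eq]
  rw [show t (2 * k - 1) / (2 * (2 / π) ^ (2 * k) * (Nat.factorial (2 * k - 1) : ℝ)) =
    t (2 * k - 1) / (Nat.factorial (2 * k - 1) : ℝ) / (2 * (2 / π) ^ (2 * k)) by
      rw [div_div, mul_comm (Nat.factorial (2 * k - 1) : ℝ)], hf]
  rw [mul_div_assoc]
  generalize (bernoulli (2 * k) : ℝ) / (Nat.factorial (2 * k) : ℝ) = b
  have h2 : (2 : ℝ) ^ (2 * k - 1) = 4 ^ k / 2 := by
    rw [eq_div_iff two_ne_zero, ← pow_succ, show 2 * k - 1 + 1 = 2 * k by omega, pow_mul]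
    norm_num
  have h3 : (-4 : ℝ) ^ k = (-1) ^ k * 4 ^ k := by rw [← mul_pow]; norm_num
  have h5 : (2 : ℝ) ^ (2 * k) = 4 ^ k := by rw [pow_mul]; norm_num
  rw [h2, h3, div_pow, div_pow, h5, one_pow, pow_succ]
  have : (4 : ℝ) ^ k ≠ 0 := by positivity
  have : π ^ (2 * k) ≠ 0 := by positivity
  field_simp
  ring
end

section
/- Let a > 0, γ > 0, α ≥ 0, c := arctan(α/γ), and let T(z) := γ · tan(aγ z + c) − α. Then for every integer n ≥ 1, the coefficient t_n := n! · (n-th Taylor coefficient of T at 0) is given by the absolutely convergent series t_n = n! a^n γ^{n+1} Σ_{k≥0} [ (−1)^{n+1} (c − π(k + 1/2))^{−(n+1)} + (−1)^{n+1} (c + π(k + 1/2))^{−(n+1)} ]. -/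
open Real

/-- The `m`-th derivative of the `k`-th term of the partial fraction expansion of `tan`. -/
noncomputable def tanTerm (m k : ℕ) (x : ℝ) : ℝ :=
  (Nat.factorial m : ℝ) * ((-1 : ℝ) ^ (m + 1) / (x - π * (k + 1 / 2)) ^ (m + 1) +
    (-1 : ℝ) ^ (m + 1) / (x + π * (k + 1 / 2)) ^ (m + 1))

lemma tan_aux_lower {r : ℝ} (h0 : 0 ≤ r) (hr : r < π / 2) (k : ℕ) {x : ℝ} (hx : |x| ≤ r) :
    (π / 2 - r) * (k + 1) ≤ π * (k + 1 / 2) - x ∧ (π / 2 - r) * (k + 1) ≤ x + π * (k + 1 / 2) := by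
  obtain ⟨h1, h2⟩ := abs_le.mp hx
  have hk : (0 : ℝ) ≤ k := Nat.cast_nonneg k
  have hp := Real.pi_pos
  have : 0 ≤ (π / 2 + r) * k := by positivity
  constructor <;> nlinarith

lemma tan_aux_ne {x : ℝ} (hx : |x| < π / 2) (k : ℕ) :
    x - π * (k + 1 / 2) ≠ 0 ∧ x + π * (k + 1 / 2) ≠ 0 := by
  obtain ⟨h1, h2⟩ := tan_aux_lower (abs_nonneg x) hx k le_rfl
  have : 0 < (π / 2 - |x|) * ((k : ℝ) + 1) := by
    have : 0 < π / 2 - |x| := by linarith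
    positivity
  constructor
  · intro h; linarith
  · intro h; linarith

lemma tanTerm_hasDerivAt (m k : ℕ) {x : ℝ} (hx : |x| < π / 2) :
    HasDerivAt (tanTerm m k) (tanTerm (m + 1) k x) x := by
  obtain ⟨h1, h2⟩ := tan_aux_ne hx k
  have e1 : HasDerivAt (fun y : ℝ => y - π * (k + 1 / 2)) 1 x := (hasDerivAt_id x).sub_const _
  have e2 : HasDerivAt (fun y : ℝ => y + π * (k + 1 / 2)) 1 x := (hasDerivAt_id x).add_const _
  have d1 := (hasDerivAt_const x ((-1 : ℝ) ^ (m + 1))).fun_div (e1.fun_pow (m + 1)) (pow_ne_zero _ h1)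
  have d2 := (hasDerivAt_const x ((-1 : ℝ) ^ (m + 1))).fun_div (e2.fun_pow (m + 1)) (pow_ne_zero _ h2)
  have d := (d1.fun_add d2).const_mul (Nat.factorial m : ℝ)
  unfold tanTerm
  refine d.congr_deriv ?_
  generalize x - π * (k + 1 / 2) = u at *
  generalize x + π * (k + 1 / 2) = v at *
  rw [Nat.factorial_succ]
  push_cast
  field_simp
  ring

lemma tanTerm_bound (m k : ℕ) {r : ℝ} (h0 : 0 ≤ r) (hr : r < π / 2) {x : ℝ} (hx : |x| ≤ r) :
    ‖tanTerm m k x‖ ≤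
      ((Nat.factorial m : ℝ) * (2 / (π / 2 - r) ^ (m + 1))) * (1 / ((k : ℝ) + 1) ^ (m + 1)) := by
  obtain ⟨h1, h2⟩ := tan_aux_lower h0 hr k hx
  have hd : 0 < π / 2 - r := by linarith
  have hD : 0 < (π / 2 - r) * ((k : ℝ) + 1) := by positivity
  have key : ∀ u : ℝ, (π / 2 - r) * ((k : ℝ) + 1) ≤ |u| →
      ‖(-1 : ℝ) ^ (m + 1) / u ^ (m + 1)‖ ≤ 1 / ((π / 2 - r) * ((k : ℝ) + 1)) ^ (m + 1) := by
    intro u hu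
    rw [norm_div, norm_pow, norm_pow, norm_neg, norm_one, one_pow, Real.norm_eq_abs]
    gcongr
  unfold tanTerm
  rw [norm_mul, Real.norm_of_nonneg (Nat.cast_nonneg _), mul_assoc]
  gcongr
  refine (norm_add_le _ _).trans ?_
  have a1 := key (x - π * (k + 1 / 2)) (by
    rw [abs_sub_comm]; exact h1.trans (le_abs_self _))
  have a2 := key (x + π * (k + 1 / 2)) (h2.trans (le_abs_self _))
  refine (add_le_add a1 a2).trans (le_of_eq ?_)
  rw [mul_pow]
  field_simp
  norm_num

lemma tan_aux_summable (m : ℕ) (hm : 1 ≤ m) (C : ℝ) :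
    Summable (fun k : ℕ => C * (1 / ((k : ℝ) + 1) ^ (m + 1))) := by
  apply Summable.mul_left
  have := (summable_nat_add_iff 1).mpr (Real.summable_one_div_nat_pow.mpr (show 1 < m + 1 by omega))
  simpa using this

lemma tanTerm_summable (m : ℕ) (hm : 1 ≤ m) {x : ℝ} (hx : |x| < π / 2) :
    Summable (fun k => tanTerm m k x) :=
  Summable.of_norm_bounded (tan_aux_summable m hm _)
    (fun k => tanTerm_bound m k (abs_nonneg x) hx le_rfl)

lemma tanTerm_tsum_hasDerivAt (m : ℕ) {x : ℝ} (hx : |x| < π / 2) :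
    HasDerivAt (fun y => ∑' k, tanTerm m k y) (∑' k, tanTerm (m + 1) k x) x := by
  obtain ⟨r, hxr, hr⟩ := exists_between hx
  have h0 : 0 < r := (abs_nonneg x).trans_lt hxr
  refine hasDerivAt_tsum_of_isPreconnected (t := Set.Ioo (-r) r)
    (tan_aux_summable (m + 1) (by omega) _) isOpen_Ioo isPreconnected_Ioo
    (fun k y hy => tanTerm_hasDerivAt m k ((abs_lt.mpr hy).trans hr))
    (fun k y hy => tanTerm_bound (m + 1) k h0.le hr (abs_lt.mpr hy).le)
    (y₀ := 0) (by simp [h0]) ?_ (abs_lt.mp hxr)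
  rcases Nat.eq_zero_or_pos m with rfl | hm
  · convert summable_zero with k
    unfold tanTerm
    have : (k : ℝ) + 1 / 2 ≠ 0 := by positivity
    simp
    field_simp
    norm_num
  · exact tanTerm_summable m hm (by simpa using Real.pi_pos)

lemma tan_aux_compl {w : ℝ} (h0 : w ≠ 0) (h1 : |w| < 1) : (w : ℂ) ∈ Complex.integerComplement := by
  rw [Complex.mem_integerComplement_iff]
  rintro ⟨n, hn⟩
  have hn' : (n : ℝ) = w := by exact_mod_cast hn
  rw [← hn'] at h0 h1
  have : |n| < 1 := by exact_mod_cast h1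
  rw [Int.abs_lt_one_iff] at this
  simp [this] at h0

lemma tsum_even_odd_aux {f : ℕ → ℂ} (hf : Summable f) :
    ∑' k, f (2 * k) + ∑' k, f (2 * k + 1) = ∑' k, f k := by
  have i1 : Function.Injective (fun k : ℕ => 2 * k) := fun a b h => by
    simp only at h; omega
  have i2 : Function.Injective (fun k : ℕ => 2 * k + 1) := fun a b h => by
    simp only at h; omega
  exact tsum_even_add_odd (hf.comp_injective i1) (hf.comp_injective i2)

lemma tan_eq_tsum {x : ℝ} (hx : |x| < π / 2) : Real.tan x = ∑' k, tanTerm 0 k x := by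
  rcases eq_or_ne x 0 with rfl | hx0
  · have : ∀ k, tanTerm 0 k 0 = 0 := by
      intro k
      unfold tanTerm
      have : (k : ℝ) + 1 / 2 ≠ 0 := by positivity
      simp
      field_simp
      norm_num
    simp [this]
  have hp := Real.pi_pos
  have hpC : (π : ℂ) ≠ 0 := by exact_mod_cast hp.ne'
  have hw1 : |x / π| < 1 / 2 := by
    rw [abs_div, abs_of_pos hp, div_lt_iff₀ hp]; linarith
  have hw0 : x / π ≠ 0 := div_ne_zero hx0 hp.ne'
  obtain ⟨w, hw⟩ : ∃ w, w = x / π := ⟨_, rfl⟩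
  rw [← hw] at hw0 hw1
  have hxw : x = π * w := by rw [hw]; field_simp
  have c1 := tan_aux_compl hw0 (by linarith)
  have c2 := tan_aux_compl (w := 2 * w) (by simpa using hw0) (by rw [abs_mul]; norm_num; linarith)
  have s1 := cot_series_rep' c1
  have s2 := cot_series_rep' c2
  have sm : Summable (fun n : ℕ => 1 / (((2 * w : ℝ) : ℂ) - (n + 1)) + 1 / (((2 * w : ℝ) : ℂ) + (n + 1))) :=
    summable_cotTerm c2
  have eo := tsum_even_odd_aux sm
  rw [← s2] at eo
  have odd : (∑' k : ℕ, (1 / (((2 * w : ℝ) : ℂ) - (((2 * k + 1 : ℕ) : ℂ) + 1)) +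
      1 / (((2 * w : ℝ) : ℂ) + (((2 * k + 1 : ℕ) : ℂ) + 1)))) =
      1 / 2 * (π * Complex.cot (π * w) - 1 / w) := by
    rw [s1, ← tsum_mul_left]
    refine tsum_congr fun k => ?_
    have : ((2 * w : ℝ) : ℂ) - (((2 * k + 1 : ℕ) : ℂ) + 1) = 2 * (w - (k + 1)) := by push_cast; ring
    rw [this]
    have : ((2 * w : ℝ) : ℂ) + (((2 * k + 1 : ℕ) : ℂ) + 1) = 2 * (w + (k + 1)) := by push_cast; ring
    rw [this, one_div_mul_eq_div, one_div, one_div, mul_inv, mul_inv]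
    ring
  have even : (∑' k : ℕ, (1 / (((2 * w : ℝ) : ℂ) - (((2 * k : ℕ) : ℂ) + 1)) +
      1 / (((2 * w : ℝ) : ℂ) + (((2 * k : ℕ) : ℂ) + 1)))) =
      -(π / 2) * ((∑' k, tanTerm 0 k x : ℝ) : ℂ) := by
    rw [Complex.ofReal_tsum, ← tsum_mul_left]
    refine tsum_congr fun k => ?_
    have : ((2 * w : ℝ) : ℂ) - (((2 * k : ℕ) : ℂ) + 1) = 2 * (w - (k + 1 / 2)) := by push_cast; ring
    rw [this]
    have : ((2 * w : ℝ) : ℂ) + (((2 * k : ℕ) : ℂ) + 1) = 2 * (w + (k + 1 / 2)) := by push_cast; ring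
    rw [this]
    have t : tanTerm 0 k x = -(π⁻¹ * (w - (k + 1 / 2))⁻¹ + π⁻¹ * (w + (k + 1 / 2))⁻¹) := by
      unfold tanTerm
      rw [hxw, ← mul_sub, ← mul_add, ← mul_inv, ← mul_inv]
      simp only [Nat.factorial_zero, Nat.cast_one, zero_add, pow_one, one_mul, neg_div, one_div,
        neg_add]
    rw [t, Complex.ofReal_neg, Complex.ofReal_add, Complex.ofReal_mul, Complex.ofReal_mul,
      Complex.ofReal_inv, Complex.ofReal_inv, Complex.ofReal_inv]
    have q1 : ((w - (k + 1 / 2) : ℝ) : ℂ) = w - (k + 1 / 2) := by push_cast; ring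
    have q2 : ((w + (k + 1 / 2) : ℝ) : ℂ) = w + (k + 1 / 2) := by push_cast; ring
    rw [q1, q2]
    generalize (w : ℂ) - (k + 1 / 2) = u
    generalize (w : ℂ) + (k + 1 / 2) = v
    have hpi : (π : ℂ) * (π : ℂ)⁻¹ = 1 := mul_inv_cancel₀ hpC
    rw [one_div, one_div, mul_inv, mul_inv]
    linear_combination (-(1 / 2 : ℂ)) * (u⁻¹ + v⁻¹) * hpi
  rw [odd, even] at eo
  have hs : Complex.sin (π * w) ≠ 0 := sin_pi_mul_ne_zero c1
  have hcr : Real.cos x ≠ 0 := (Real.cos_pos_of_mem_Ioo (abs_lt.mp hx |>.imp (by intro h; linarith) id)).ne'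
  have hc : Complex.cos (π * w) ≠ 0 := by
    rw [hxw] at hcr; exact_mod_cast hcr
  have hwC : (w : ℂ) ≠ 0 := by exact_mod_cast hw0
  have trig : Complex.tan (π * w) = Complex.cot (π * w) - 2 * Complex.cot (π * ((2 * w : ℝ) : ℂ)) := by
    have : (π : ℂ) * ((2 * w : ℝ) : ℂ) = 2 * (π * w) := by push_cast; ring
    rw [this, Complex.cot, Complex.cot, Complex.tan, Complex.sin_two_mul, Complex.cos_two_mul']
    field_simp
    ring
  have fin : Complex.tan (π * w) = ((∑' k, tanTerm 0 k x : ℝ) : ℂ) := by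
    rw [trig]
    have e2 : (1 : ℂ) / ((2 * w : ℝ) : ℂ) = 1 / 2 * (1 / w) := by push_cast; field_simp
    rw [e2] at eo
    apply mul_left_cancel₀ hpC
    linear_combination (2 : ℂ) * eo
  have fin2 : ((Real.tan x : ℝ) : ℂ) = Complex.tan (π * w) := by
    rw [hxw, Complex.ofReal_tan, Complex.ofReal_mul]
  exact Complex.ofReal_injective (fin2.trans fin)

lemma iteratedDeriv_tan_aux (a γ α c : ℝ) (m : ℕ) :
    ∀ z : ℝ, |a * γ * z + c| < π / 2 →
      iteratedDeriv m (fun z => γ * Real.tan (a * γ * z + c) - α) z =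
        γ * (a * γ) ^ m * (∑' k, tanTerm m k (a * γ * z + c)) - (if m = 0 then α else 0) := by
  induction m with
  | zero =>
    intro z hz
    simp [tan_eq_tsum hz]
  | succ m ih =>
    intro z hz
    rw [iteratedDeriv_succ]
    have hop : IsOpen {z : ℝ | |a * γ * z + c| < π / 2} :=
      isOpen_lt (by fun_prop) continuous_const
    have hev := Filter.eventuallyEq_of_mem (hop.mem_nhds hz) ih
    rw [hev.deriv_eq]
    have l : HasDerivAt (fun z : ℝ => a * γ * z + c) (a * γ) z := by
      simpa using ((hasDerivAt_id z).const_mul (a * γ)).add_const c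
    have := (((tanTerm_tsum_hasDerivAt m hz).comp z l).const_mul (γ * (a * γ) ^ m)).sub_const
      (if m = 0 then α else 0)
    refine Eq.trans this.deriv ?_
    rw [if_neg (Nat.succ_ne_zero m)]
    ring

/-- For `a > 0`, `γ > 0`, `α ≥ 0`, `c = arctan(α/γ)` and
`T(z) = γ tan(aγz + c) − α`, for every `n ≥ 1` the coefficient
`t_n = n! · [z^n] T = iteratedDeriv n T 0` is given by the absolutely convergent series
`t_n = n! a^n γ^{n+1} Σ_{k≥0} ((−1)^{n+1} (c − π(k+1/2))^{−(n+1)}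
       + (−1)^{n+1} (c + π(k+1/2))^{−(n+1)})`. -/
theorem unary_binary_coeff_series (a γ α : ℝ) (ha : 0 < a) (hγ : 0 < γ) (hα : 0 ≤ α)
    (c : ℝ) (hc : c = Real.arctan (α / γ))
    (T : ℝ → ℝ) (hT : T = fun z => γ * Real.tan (a * γ * z + c) - α)
    (n : ℕ) (hn : 1 ≤ n) :
    Summable (fun k : ℕ =>
      |(-1 : ℝ) ^ (n + 1) / (c - π * (k + 1 / 2)) ^ (n + 1) +
        (-1 : ℝ) ^ (n + 1) / (c + π * (k + 1 / 2)) ^ (n + 1)|) ∧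
    iteratedDeriv n T 0 =
      (Nat.factorial n : ℝ) * a ^ n * γ ^ (n + 1) *
        ∑' k : ℕ,
          ((-1 : ℝ) ^ (n + 1) / (c - π * (k + 1 / 2)) ^ (n + 1) +
            (-1 : ℝ) ^ (n + 1) / (c + π * (k + 1 / 2)) ^ (n + 1)) := by
  have habs : |c| < π / 2 := by
    rw [hc, abs_lt]
    exact ⟨Real.neg_pi_div_two_lt_arctan _, Real.arctan_lt_pi_div_two _⟩
  have hfac : (Nat.factorial n : ℝ) ≠ 0 := by positivity
  constructor
  · have h := ((tanTerm_summable n hn habs).mul_left (Nat.factorial n : ℝ)⁻¹).abs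
    refine h.congr fun k => ?_
    rw [tanTerm, inv_mul_cancel_left₀ hfac]
  · rw [hT, iteratedDeriv_tan_aux a γ α c n 0 (by simpa using habs), if_neg (by omega)]
    simp only [mul_zero, zero_add, sub_zero, tanTerm]
    rw [tsum_mul_left]
    ring
end

section
/- Let a > 0, γ > 0, α > 0, c := arctan(α/γ), and let T(z) := γ · tan(aγ z + c) − α. Then the coefficients t_n := n! · (n-th Taylor coefficient of T at 0) satisfy the asymptotic equivalence t_n ~ n! a^n γ^{n+1} / (π/2 − c)^{n+1} as n → ∞; that is, lim_{n→∞} t_n (π/2 − c)^{n+1} / (n! a^n γ^{n+1}) = 1. -/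
open Real Filter

/-- Taking real parts commutes with iterated derivatives along the real line. -/
lemma iteratedDeriv_re_ofReal (n : ℕ) : ∀ (F : ℂ → ℂ) (x : ℝ), AnalyticAt ℂ F (x : ℂ) →
    iteratedDeriv n (fun y : ℝ => (F (y : ℂ)).re) x = (iteratedDeriv n F (x : ℂ)).re := by
  induction n with
  | zero => intro F x _; simp
  | succ n ih =>
    intro F x hF
    rw [iteratedDeriv_succ', iteratedDeriv_succ', ← ih (deriv F) x hF.deriv]
    apply Filter.EventuallyEq.iteratedDeriv_eq
    have h1 : ∀ᶠ z in nhds (x : ℂ), AnalyticAt ℂ F z := hF.eventually_analyticAt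
    have h2 : ∀ᶠ y : ℝ in nhds x, AnalyticAt ℂ F (y : ℂ) :=
      (Complex.continuous_ofReal.tendsto x).eventually h1
    filter_upwards [h2] with y hy
    exact (hy.differentiableAt.hasDerivAt.real_of_complex).deriv

/-- The entire function `sin u / u`. -/
noncomputable def sincC : ℂ → ℂ := dslope Complex.sin 0

/-- The regular part `cot u - 1 / u` of the cotangent. -/
noncomputable def cotReg (u : ℂ) : ℂ :=
  dslope (fun u => Complex.cos u - sincC u) 0 u / sincC u

lemma sincC_zero : sincC 0 = 1 := by simp [sincC]

lemma sincC_of_ne {u : ℂ} (hu : u ≠ 0) : sincC u = Complex.sin u / u := by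
  simp [sincC, dslope_of_ne _ hu, slope_def_field]

lemma differentiable_dslope_zero {f : ℂ → ℂ} (hf : Differentiable ℂ f) :
    Differentiable ℂ (dslope f 0) := by
  rw [← differentiableOn_univ] at hf ⊢
  exact (Complex.differentiableOn_dslope Filter.univ_mem).2 hf

lemma differentiable_sincC : Differentiable ℂ sincC :=
  differentiable_dslope_zero Complex.differentiable_sin

lemma sincC_ne_zero {u : ℂ} (h1 : -π < u.re) (h2 : u.re < π) : sincC u ≠ 0 := by
  by_cases hu : u = 0
  · rw [hu, sincC_zero]; exact one_ne_zero
  · rw [sincC_of_ne hu]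
    refine div_ne_zero (fun h => hu ?_) hu
    obtain ⟨k, hk⟩ := Complex.sin_eq_zero_iff.1 h
    have hre : u.re = k * π := by rw [hk]; simp
    rw [hre] at h1 h2
    have hp := Real.pi_pos
    have k1 : (k : ℝ) < 1 := by nlinarith
    have k2 : (-1 : ℝ) < k := by nlinarith
    have k1' : k < 1 := by exact_mod_cast k1
    have k2' : -1 < k := by exact_mod_cast k2
    have : k = 0 := by omega
    rw [hk, this]; simp

lemma differentiableAt_cotReg {u : ℂ} (h1 : -π < u.re) (h2 : u.re < π) :
    DifferentiableAt ℂ cotReg u := by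
  have h := differentiable_dslope_zero (Complex.differentiable_cos.sub differentiable_sincC)
  exact (h u).div (differentiable_sincC u) (sincC_ne_zero h1 h2)

lemma cotReg_eq {u : ℂ} (hu : u ≠ 0) (hs : Complex.sin u ≠ 0) :
    u⁻¹ + cotReg u = Complex.cos u / Complex.sin u := by
  rw [cotReg, dslope_of_ne _ hu, slope_def_field, sincC_zero, sincC_of_ne hu, Complex.cos_zero]
  field_simp
  ring

theorem unary_binary_coeff_asymptotic (a γ α : ℝ) (ha : 0 < a) (hγ : 0 < γ) (hα : 0 < α)
    (c : ℝ) (hc : c = Real.arctan (α / γ))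
    (T : ℝ → ℝ) (hT : T = fun z => γ * Real.tan (a * γ * z + c) - α) :
    Tendsto (fun n : ℕ =>
        iteratedDeriv n T 0 * (π / 2 - c) ^ (n + 1) /
          ((Nat.factorial n : ℝ) * a ^ n * γ ^ (n + 1)))
      atTop (nhds 1) := by
  have hp := Real.pi_pos
  have hc0 : 0 < c := by rw [hc]; exact Real.arctan_pos.2 (div_pos hα hγ)
  have hc1 : c < π / 2 := by rw [hc]; exact Real.arctan_lt_pi_div_two _
  obtain ⟨ρ, hρ⟩ : ∃ ρ, ρ = π / 2 - c := ⟨_, rfl⟩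
  obtain ⟨b, hb⟩ : ∃ b, b = a * γ := ⟨_, rfl⟩
  have hb0 : 0 < b := by rw [hb]; positivity
  have hρ0 : 0 < ρ := by linarith
  have hρ1 : ρ < π / 2 := by linarith
  rw [← hρ]
  -- the polar part and the regular part
  let P : ℂ → ℂ := fun z => (γ : ℂ) * ((-b : ℂ) * z + ρ)⁻¹
  let H : ℂ → ℂ := fun z => (γ : ℂ) * cotReg ((-b : ℂ) * z + ρ) - α
  obtain ⟨r, hr⟩ : ∃ r, r = π / 2 / b := ⟨_, rfl⟩
  have hr0 : 0 < r := by rw [hr]; positivity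
  have hbr : b * r = π / 2 := by rw [hr]; field_simp
  have hHd : ∀ z ∈ Metric.closedBall (0 : ℂ) r, DifferentiableAt ℂ H z := by
    intro z hz
    rw [mem_closedBall_zero_iff] at hz
    have hre : |z.re| ≤ r := (Complex.abs_re_le_norm z).trans hz
    have hre' := abs_le.1 hre
    have e : ((-b : ℂ) * z + ρ).re = -b * z.re + ρ := by simp
    have h1 : -π < ((-b : ℂ) * z + ρ).re := by rw [e]; nlinarith
    have h2 : ((-b : ℂ) * z + ρ).re < π := by rw [e]; nlinarith
    have h3 : DifferentiableAt ℂ (fun z : ℂ => (-b : ℂ) * z + ρ) z := by fun_prop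
    have h4 := (differentiableAt_cotReg h1 h2).comp z h3
    exact (h4.const_mul (γ : ℂ)).sub_const (α : ℂ)
  have hHan : AnalyticAt ℂ H 0 := by
    have : DifferentiableOn ℂ H (Metric.ball 0 r) := fun z hz =>
      (hHd z (Metric.ball_subset_closedBall hz)).differentiableWithinAt
    exact this.analyticAt (Metric.ball_mem_nhds _ hr0)
  have hρC : (ρ : ℂ) ≠ 0 := by exact_mod_cast hρ0.ne'
  have hPan : AnalyticAt ℂ P 0 := by
    apply AnalyticAt.mul analyticAt_const
    apply AnalyticAt.inv
    · fun_prop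
    · simpa using hρC
  -- T agrees with the complex function near 0
  have hTF : T =ᶠ[nhds 0] fun y : ℝ => ((fun z => P z + H z) (y : ℂ)).re := by
    have hu : ∀ᶠ y : ℝ in nhds 0, -b * y + ρ ∈ Set.Ioo 0 π := by
      have hcont : Continuous fun y : ℝ => -b * y + ρ := by fun_prop
      apply hcont.continuousAt.eventually
      apply Ioo_mem_nhds <;> simp <;> linarith
    filter_upwards [hu] with y hy
    have hs : Real.sin (-b * y + ρ) ≠ 0 := (Real.sin_pos_of_pos_of_lt_pi hy.1 hy.2).ne'
    have e : ((-b : ℂ) * y + ρ) = ((-b * y + ρ : ℝ) : ℂ) := by push_cast; rfl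
    have hsC : Complex.sin ((-b * y + ρ : ℝ) : ℂ) ≠ 0 := by
      rw [← Complex.ofReal_sin]; exact_mod_cast hs
    have huC : ((-b * y + ρ : ℝ) : ℂ) ≠ 0 := by exact_mod_cast hy.1.ne'
    have key := cotReg_eq huC hsC
    have e2 : P y + H y = ((γ * (Real.cos (-b * y + ρ) / Real.sin (-b * y + ρ)) - α : ℝ) : ℂ) := by
      simp only [P, H, e]
      rw [← add_sub_assoc, ← mul_add, key]
      push_cast
      rfl
    have e3 : Real.tan (a * γ * y + c) = Real.cos (-b * y + ρ) / Real.sin (-b * y + ρ) := by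
      have : -b * y + ρ = π / 2 - (a * γ * y + c) := by rw [hρ, hb]; ring
      rw [this, Real.cos_pi_div_two_sub, Real.sin_pi_div_two_sub, Real.tan_eq_sin_div_cos]
    simp only [e2, Complex.ofReal_re, hT, e3]
  have hder : ∀ n : ℕ, iteratedDeriv n T 0 =
      γ * n.factorial * b ^ n / ρ ^ (n + 1) + (iteratedDeriv n H 0).re := by
    intro n
    rw [hTF.iteratedDeriv_eq, iteratedDeriv_re_ofReal n (fun z => P z + H z) 0 (by
      rw [Complex.ofReal_zero]; exact hPan.add hHan)]
    rw [Complex.ofReal_zero, iteratedDeriv_fun_add hPan.contDiffAt hHan.contDiffAt, Complex.add_re]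
    congr 1
    have : iteratedDeriv n P 0 = ((γ * n.factorial * b ^ n / ρ ^ (n + 1) : ℝ) : ℂ) := by
      simp only [P]
      rw [iteratedDeriv_const_mul_field, iteratedDeriv_eq_iterate, iter_deriv_inv_linear]
      have hz : (-1 - (n : ℤ)) = -((n + 1 : ℕ) : ℤ) := by push_cast; ring
      simp only [mul_zero, zero_add]
      rw [hz, zpow_neg, zpow_natCast]
      push_cast
      have : (-1 : ℂ) ^ n * (-(b : ℂ)) ^ n = (b : ℂ) ^ n := by
        rw [← mul_pow]; simp
      rw [div_eq_mul_inv, ← this]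
      ring
    rw [this, Complex.ofReal_re]
  -- Cauchy estimate
  obtain ⟨C, hC⟩ := (isCompact_closedBall (0 : ℂ) r).exists_bound_of_continuousOn
    (f := H) (fun z hz => (hHd z hz).continuousAt.continuousWithinAt)
  have hcauchy : ∀ n : ℕ, |(iteratedDeriv n H 0).re| ≤ n.factorial * C / r ^ n := by
    intro n
    refine (Complex.abs_re_le_norm _).trans ?_
    apply Complex.norm_iteratedDeriv_le_of_forall_mem_sphere_norm_le n hr0
    · apply DifferentiableOn.diffContOnCl
      rw [closure_ball _ hr0.ne']
      exact fun z hz => (hHd z hz).differentiableWithinAt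
    · exact fun z hz => hC z (Metric.sphere_subset_closedBall hz)
  have hsplit : ∀ n : ℕ, iteratedDeriv n T 0 * ρ ^ (n + 1) /
          ((Nat.factorial n : ℝ) * a ^ n * γ ^ (n + 1)) =
      1 + (iteratedDeriv n H 0).re * (ρ ^ (n + 1) / (n.factorial * b ^ n * γ)) := by
    intro n
    have hf : (n.factorial : ℝ) ≠ 0 := by positivity
    have : (n.factorial : ℝ) * a ^ n * γ ^ (n + 1) = n.factorial * b ^ n * γ := by
      rw [hb, mul_pow]; ring
    rw [this, hder]
    field_simp
  simp_rw [hsplit]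
  have hlim : Tendsto (fun n : ℕ => (iteratedDeriv n H 0).re *
      (ρ ^ (n + 1) / (n.factorial * b ^ n * γ))) atTop (nhds 0) := by
    have hg : Tendsto (fun n : ℕ => C * ρ / γ * (ρ / (π / 2)) ^ n) atTop (nhds 0) := by
      have := (tendsto_pow_atTop_nhds_zero_of_lt_one (r := ρ / (π / 2)) (by positivity)
        ((div_lt_one (by positivity)).2 hρ1)).const_mul (C * ρ / γ)
      simpa using this
    refine squeeze_zero_norm (fun n => ?_) hg
    rw [Real.norm_eq_abs, abs_mul, abs_of_pos (a := ρ ^ (n + 1) / _) (by positivity)]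
    refine (mul_le_mul_of_nonneg_right (hcauchy n) (by positivity)).trans (le_of_eq ?_)
    rw [← hbr]
    have hf : (n.factorial : ℝ) ≠ 0 := by positivity
    rw [div_pow, mul_pow]
    field_simp
    ring
  simpa using hlim.const_add 1
end
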